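/- Differential operators of invariant symbols preserve invariants: if δ ∈ S(g*)^g and P ∈ S(g)^g, then δ(∂)P ∈ S(g)^g. -/

import Mathlib

noncomputable section
set_option linter.unusedSectionVars false

variable {K : Type} [Field K] [CharZero K]
variable {L : Type} [LieRing L] [LieAlgebra K L]
variable {m : ℕ}

/-- The degree-one polynomial representing `y ∈ g` in the coordinates given by `b`. -/
def linPoly (b : Module.Basis (Fin m) K L) (y : L) : MvPolynomial (Fin m) K :=
  ∑ j, b.repr y j • MvPolynomial.X j

/-- The adjoint action of `x ∈ g` on `S(g)`, extended from `g` as a derivation. -/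
def adS (b : Module.Basis (Fin m) K L) (x : L) :
    MvPolynomial (Fin m) K →ₗ[K] MvPolynomial (Fin m) K :=
  (MvPolynomial.mkDerivation K fun i => linPoly b ⁅x, b i⁆).toLinearMap

/-- The coadjoint action of `x ∈ g` on `S(g*)`, written in dual basis coordinates, extended
from `g*` as a derivation ((x·φ)(y) = −φ([x,y])). -/
def coadS (b : Module.Basis (Fin m) K L) (x : L) :
    MvPolynomial (Fin m) K →ₗ[K] MvPolynomial (Fin m) K :=
  (MvPolynomial.mkDerivation K fun i =>
    ∑ j, (-(b.repr ⁅x, b j⁆ i)) • MvPolynomial.X j).toLinearMap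

/-- The differential operator `∂^α = ∏ᵢ (∂/∂bᵢ)^(α i)` on `S(g)`. -/
def diffOpMon (α : Fin m →₀ ℕ) : Module.End K (MvPolynomial (Fin m) K) :=
  ((List.finRange m).map fun i =>
    (((MvPolynomial.pderiv i).toLinearMap : Module.End K (MvPolynomial (Fin m) K)) ^ (α i))).prod

/-- The constant-coefficient differential operator `δ(∂)` applied to `P`; each dual basis
vector `bᵢ*` occurring in `δ` is replaced by `∂/∂bᵢ`. -/
def diffOp (δ P : MvPolynomial (Fin m) K) : MvPolynomial (Fin m) K :=
  ∑ α ∈ δ.support, MvPolynomial.coeff α δ • diffOpMon (K := K) α P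

theorem List.prod_map_pow_update_add_one {ι M : Type*} [DecidableEq ι] [Monoid M] (f : ι → M)
    (hf : ∀ i j, Commute (f i) (f j)) (e : ι → ℕ) (k : ι) {l : List ι} (hl : l.Nodup)
    (hk : k ∈ l) :
    (l.map fun i => f i ^ Function.update e k (e k + 1) i).prod
      = f k * (l.map fun i => f i ^ e i).prod := by
  induction l with
  | nil => simp at hk
  | cons a l ih =>
    rw [List.nodup_cons] at hl
    simp only [List.map_cons, List.prod_cons]
    by_cases ha : a = k
    · subst ha
      rw [Function.update_self, pow_succ', mul_assoc]
      congr 3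
      refine List.map_congr_left fun i hi => ?_
      rw [Function.update_of_ne (ne_of_mem_of_not_mem hi hl.1)]
    · rw [ih hl.2 (List.mem_of_ne_of_mem (Ne.symm ha) hk), Function.update_of_ne ha, ← mul_assoc,
        ← mul_assoc, ((hf a k).pow_left _).eq]

theorem MvPolynomial.pderiv_commute (i j : Fin m) :
    Commute ((pderiv i).toLinearMap : Module.End K (MvPolynomial (Fin m) K))
      (pderiv j).toLinearMap := by
  have h : ⁅pderiv (R := K) i, pderiv (R := K) j⁆ = 0 := by
    refine MvPolynomial.derivation_ext fun n => ?_
    simp [Derivation.commutator_apply, pderiv_X, Pi.single_apply, apply_ite]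
  refine LinearMap.ext fun p => ?_
  simpa [Derivation.commutator_apply, sub_eq_zero] using DFunLike.congr_fun h p

theorem diffOpMon_zero : diffOpMon (K := K) (0 : Fin m →₀ ℕ) = 1 := by
  simp [diffOpMon]

theorem diffOpMon_add_single (α : Fin m →₀ ℕ) (k : Fin m) :
    diffOpMon (K := K) (α + Finsupp.single k 1)
      = (MvPolynomial.pderiv k).toLinearMap * diffOpMon α := by
  have h : ⇑(α + Finsupp.single k 1 : Fin m →₀ ℕ) = Function.update α k (α k + 1) := by
    ext i
    by_cases hi : i = k
    · subst hi; simp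
    · simp [hi]
  simp only [diffOpMon, congrFun h]
  exact List.prod_map_pow_update_add_one
    (fun i => ((MvPolynomial.pderiv i).toLinearMap : Module.End K (MvPolynomial (Fin m) K)))
    MvPolynomial.pderiv_commute α k (List.nodup_finRange m) (List.mem_finRange k)

/-- The operator `δ(∂)` as a linear function of its symbol `δ`. -/
def diffOpLin : MvPolynomial (Fin m) K →ₗ[K] Module.End K (MvPolynomial (Fin m) K) :=
  (MvPolynomial.basisMonomials (Fin m) K).constr K (diffOpMon (K := K))

theorem diffOpLin_monomial (α : Fin m →₀ ℕ) (c : K) :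
    diffOpLin (MvPolynomial.monomial α c) = c • diffOpMon (K := K) α := by
  have h : diffOpLin (MvPolynomial.monomial α (1 : K)) = diffOpMon (K := K) α := by
    rw [diffOpLin, ← (MvPolynomial.basisMonomials (Fin m) K).constr_basis K (diffOpMon (K := K)) α,
      MvPolynomial.coe_basisMonomials]
  rw [← h, ← map_smul, MvPolynomial.smul_monomial, smul_eq_mul, mul_one]

theorem diffOp_eq_diffOpLin (δ P : MvPolynomial (Fin m) K) : diffOp δ P = diffOpLin δ P := by
  conv_rhs => rw [δ.as_sum]
  simp only [diffOp, map_sum, diffOpLin_monomial, LinearMap.sum_apply, LinearMap.smul_apply]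

theorem diffOpLin_C (c : K) : diffOpLin (MvPolynomial.C c : MvPolynomial (Fin m) K) = c • 1 := by
  rw [MvPolynomial.C_apply, diffOpLin_monomial, diffOpMon_zero]

theorem diffOpLin_mul_X (p : MvPolynomial (Fin m) K) (k : Fin m) :
    diffOpLin (p * MvPolynomial.X k) = (MvPolynomial.pderiv k).toLinearMap * diffOpLin p := by
  induction p using MvPolynomial.induction_on' with
  | monomial α c =>
    rw [MvPolynomial.X, MvPolynomial.monomial_mul, mul_one, diffOpLin_monomial,
      diffOpLin_monomial, diffOpMon_add_single, mul_smul_comm]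
  | add p q hp hq => rw [add_mul, map_add, map_add, hp, hq, mul_add]

theorem coadS_C (b : Module.Basis (Fin m) K L) (x : L) (c : K) :
    coadS b x (MvPolynomial.C c) = 0 := by
  simp [coadS]

theorem coadS_mul_X (b : Module.Basis (Fin m) K L) (x : L) (p : MvPolynomial (Fin m) K)
    (k : Fin m) :
    coadS b x (p * MvPolynomial.X k) = coadS b x p * MvPolynomial.X k
      + ∑ j, (-(b.repr ⁅x, b j⁆ k)) • (p * MvPolynomial.X j) := by
  simp [coadS, Derivation.leibniz, MvPolynomial.mkDerivation_X, Finset.mul_sum, mul_comm, add_comm]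

theorem Derivation.finset_sum_apply {ι R A M : Type*} [CommSemiring R] [CommSemiring A]
    [AddCommMonoid M] [Algebra R A] [Module A M] [Module R M] (s : Finset ι)
    (D : ι → Derivation R A M) (a : A) : (∑ i ∈ s, D i) a = ∑ i ∈ s, D i a := by
  have h := map_sum (Derivation.coeFnAddMonoidHom (R := R) (A := A) (M := M)) D s
  exact (congrFun h a).trans (Finset.sum_apply a s _)

theorem adS_pderiv (b : Module.Basis (Fin m) K L) (x : L) (k : Fin m)
    (Q : MvPolynomial (Fin m) K) :
    adS b x (MvPolynomial.pderiv k Q) = MvPolynomial.pderiv k (adS b x Q)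
      + ∑ j, (-(b.repr ⁅x, b j⁆ k)) • MvPolynomial.pderiv j Q := by
  set D := MvPolynomial.mkDerivation K fun i => linPoly b ⁅x, b i⁆
  have h : ⁅D, MvPolynomial.pderiv (R := K) k⁆
      = ∑ j, (-(b.repr ⁅x, b j⁆ k)) • MvPolynomial.pderiv j := by
    refine MvPolynomial.derivation_ext fun n => ?_
    simp [Derivation.commutator_apply, D, MvPolynomial.pderiv_X, Pi.single_apply, apply_ite,
      linPoly, MvPolynomial.mkDerivation_X, Derivation.finset_sum_apply]
  have hQ := DFunLike.congr_fun h Q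
  simp only [Derivation.commutator_apply, Derivation.finset_sum_apply,
    Derivation.smul_apply] at hQ
  exact sub_eq_iff_eq_add'.mp hQ

/-- The commutator of the adjoint action with `δ(∂)` is the operator whose symbol is the coadjoint
action on `δ`. -/
theorem adS_diffOpLin (b : Module.Basis (Fin m) K L) (x : L) (δ P : MvPolynomial (Fin m) K) :
    adS b x (diffOpLin δ P) = diffOpLin δ (adS b x P) + diffOpLin (coadS b x δ) P := by
  induction δ using MvPolynomial.induction_on with
  | C c => simp [diffOpLin_C, coadS_C]
  | add p q hp hq =>
    simp only [map_add, LinearMap.add_apply, hp, hq]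
    abel
  | mul_X p k hp =>
    simp only [coadS_mul_X, map_add, map_sum, map_smul, diffOpLin_mul_X, LinearMap.add_apply,
      LinearMap.sum_apply, LinearMap.smul_apply, Module.End.mul_apply, Derivation.coeFn_coe,
      adS_pderiv, hp, add_assoc]

/-- Differential operators with invariant symbols preserve invariants: if `δ ∈ S(g*)^g` and
`P ∈ S(g)^g` then `δ(∂)P ∈ S(g)^g`. -/
theorem diffOp_of_invariants_preserves_invariants (b : Module.Basis (Fin m) K L)
    (δ P : MvPolynomial (Fin m) K)
    (hδ : ∀ x : L, coadS b x δ = 0) (hP : ∀ x : L, adS b x P = 0) :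
    ∀ x : L, adS b x (diffOp δ P) = 0 := by
  intro x
  rw [diffOp_eq_diffOpLin, adS_diffOpLin, hδ, hP, map_zero, map_zero, LinearMap.zero_apply,
    add_zero]

end
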